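/- The diagonal quaternary quadratic form x² + y² + z² + 7w² primitively represents every positive integer except exactly 4. -/

import Mathlib

theorem exists_translate_abs_le_half {a : ℤ} (b : ℤ) (ha : 0 < a) :
    ∃ t : ℤ, -a ≤ 2 * (b + a * t) ∧ 2 * (b + a * t) ≤ a := by
  have h₁ := Int.emod_nonneg (2 * b + a) (show 2 * a ≠ 0 by positivity)
  have h₂ := Int.emod_lt_of_pos (2 * b + a) (show 0 < 2 * a by positivity)
  have h₃ := Int.mul_ediv_add_emod (2 * b + a) (2 * a)
  exact ⟨-((2 * b + a) / (2 * a)), by linarith, by linarith⟩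

/-- A positive definite binary form `A u² + 2 B u v + C v²` of determinant `D` is properly
equivalent to one whose leading coefficient `A'` satisfies `3 A'² ≤ 4 D`. -/
theorem exists_unimodular_reduced_binary (A B C : ℤ) (hA : 0 < A) (hD : 0 < A * C - B ^ 2) :
    ∃ p q r s : ℤ, p * s - q * r = 1 ∧ 0 < A * p ^ 2 + 2 * B * p * r + C * r ^ 2 ∧
      3 * (A * p ^ 2 + 2 * B * p * r + C * r ^ 2) ^ 2 ≤ 4 * (A * C - B ^ 2) := by
  induction hN : A.toNat using Nat.strong_induction_on generalizing A B C with
  | _ N ih =>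
    obtain ⟨t, ht₁, ht₂⟩ := exists_translate_abs_le_half B hA
    set B' := B + A * t with hB'
    set C' := A * t ^ 2 + 2 * B * t + C with hC'
    have hdet : A * C' - B' ^ 2 = A * C - B ^ 2 := by rw [hB', hC']; ring
    have hsq : 4 * B' ^ 2 ≤ A ^ 2 := by
      linarith [mul_nonneg (sub_nonneg.2 ht₁) (sub_nonneg.2 ht₂)]
    have hC'_pos : 0 < C' := by
      by_contra! h
      linarith [sq_nonneg B', mul_nonneg hA.le (neg_nonneg.2 h)]
    rcases le_or_gt A C' with hle | hlt
    · refine ⟨1, 0, 0, 1, by ring, by simpa using hA, ?_⟩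
      have : A * A ≤ A * C' := mul_le_mul_of_nonneg_left hle hA.le
      rw [← hdet]
      nlinarith
    · obtain ⟨p, q, r, s, h₁, h₂, h₃⟩ := ih C'.toNat (by omega) C' (-B') A hC'_pos
        (by linarith [hdet, mul_comm A C', neg_sq B']) rfl
      have hval : A * (t * p - r) ^ 2 + 2 * B * (t * p - r) * p + C * p ^ 2 =
          C' * p ^ 2 + 2 * (-B') * p * r + A * r ^ 2 := by rw [hB', hC']; ring
      refine ⟨t * p - r, t * q - s, p, q, by linear_combination h₁, by rw [hval]; exact h₂, ?_⟩
      rw [hval]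
      linarith [hdet, mul_comm A C', neg_sq B']

theorem reduced_leading_coeffs_eq {a b g : ℤ} (ha : 0 < a) (hab : a ≤ b) (hg₁ : -a ≤ 2 * g)
    (hg₂ : 2 * g ≤ a) (hD : 0 < a * b - g ^ 2) (hD' : 3 * (a * b - g ^ 2) ^ 2 ≤ 4 * a) :
    a = 1 ∧ b = 1 ∧ g = 0 := by
  have hsq : 4 * g ^ 2 ≤ a ^ 2 := by
    linarith [mul_nonneg (sub_nonneg.2 hg₁) (sub_nonneg.2 hg₂)]
  have h₁ : a * a ≤ a * b := mul_le_mul_of_nonneg_left hab ha.le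
  have h₂ : 3 * a ^ 2 ≤ 4 * (a * b - g ^ 2) := by linarith
  have h₃ : (3 * a ^ 2) ^ 2 ≤ (4 * (a * b - g ^ 2)) ^ 2 :=
    pow_le_pow_left₀ (by positivity) h₂ 2
  have h₄ : a * (27 * a ^ 3) ≤ a * 64 := by linarith
  have h₅ : 27 * a ^ 3 ≤ 64 := le_of_mul_le_mul_left h₄ ha
  obtain rfl : a = 1 := by
    by_contra hne
    have : 2 ^ 3 ≤ a ^ 3 := pow_le_pow_left₀ (by norm_num) (by omega) 3
    linarith
  obtain rfl : g = 0 := by omega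
  exact ⟨rfl, by nlinarith, rfl⟩

/-- Every value of a positive definite integral ternary form of determinant one is a sum of
three squares. -/
theorem ternary_det_one_sum_three_sq (a b c d e g : ℤ) (ha : 0 < a) (hab : 0 < a * b - g ^ 2)
    (hdet : a * b * c + 2 * d * e * g - a * d ^ 2 - b * e ^ 2 - c * g ^ 2 = 1) (x y z : ℤ) :
    ∃ u v w : ℤ, u ^ 2 + v ^ 2 + w ^ 2 =
      a * x ^ 2 + b * y ^ 2 + c * z ^ 2 + 2 * d * y * z + 2 * e * x * z + 2 * g * x * y := by
  induction hN : a.toNat using Nat.strong_induction_on generalizing a b c d e g x y z with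
  | _ N ih =>
    have hbin : (a * b - g ^ 2) * (a * c - e ^ 2) - (a * d - g * e) ^ 2 = a := by
      linear_combination a * hdet
    obtain ⟨p, q, r, s, hps, hA, hA'⟩ := exists_unimodular_reduced_binary (a * b - g ^ 2)
      (a * d - g * e) (a * c - e ^ 2) hab (by rw [hbin]; exact ha)
    rw [hbin] at hA'
    set g₀ := g * p + e * r with hg₀
    obtain ⟨t, ht₁, ht₂⟩ := exists_translate_abs_le_half g₀ ha
    -- the form in the coordinates `x = x' + t y'`, `y = p y' + q z'`, `z = r y' + s z'`
    set g' := g₀ + a * t with hg'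
    set e' := g * q + e * s with he'
    set b' := a * t ^ 2 + b * p ^ 2 + c * r ^ 2 + 2 * d * p * r + 2 * e * t * r + 2 * g * t * p
      with hb'
    set c' := b * q ^ 2 + c * s ^ 2 + 2 * d * q * s with hc'
    set d' := b * p * q + c * r * s + d * (p * s + q * r) + e * t * s + g * t * q with hd'
    have hA_eq : (a * b - g ^ 2) * p ^ 2 + 2 * (a * d - g * e) * p * r + (a * c - e ^ 2) * r ^ 2 =
        a * b' - g' ^ 2 := by rw [hb', hg', hg₀]; ring
    rw [hA_eq] at hA hA'
    have hdet' : a * b' * c' + 2 * d' * e' * g' - a * d' ^ 2 - b' * e' ^ 2 - c' * g' ^ 2 = 1 := by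
      have : a * b' * c' + 2 * d' * e' * g' - a * d' ^ 2 - b' * e' ^ 2 - c' * g' ^ 2 =
          (a * b * c + 2 * d * e * g - a * d ^ 2 - b * e ^ 2 - c * g ^ 2) *
            (p * s - q * r) ^ 2 := by
        rw [hb', hc', hd', he', hg', hg₀]; ring
      rw [this, hdet, hps]; norm_num
    obtain ⟨x', y', z', hx, hy, hz⟩ :
        ∃ x' y' z' : ℤ, x = x' + t * y' ∧ y = p * y' + q * z' ∧ z = r * y' + s * z' :=
      ⟨x - t * (s * y - q * z), s * y - q * z, p * z - r * y, by ring,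
        by linear_combination -y * hps, by linear_combination -z * hps⟩
    have hval : a * x ^ 2 + b * y ^ 2 + c * z ^ 2 + 2 * d * y * z + 2 * e * x * z + 2 * g * x * y =
        a * x' ^ 2 + b' * y' ^ 2 + c' * z' ^ 2 + 2 * d' * y' * z' + 2 * e' * x' * z' +
          2 * g' * x' * y' := by
      rw [hx, hy, hz, hb', hc', hd', he', hg', hg₀]; ring
    rw [hval]
    clear_value b' c' d' e' g'
    have hb'_pos : 0 < b' := by
      by_contra! h
      linarith [sq_nonneg g', mul_nonneg ha.le (neg_nonneg.2 h)]
    rcases lt_or_ge b' a with hlt | hge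
    · obtain ⟨u, v, w, h⟩ := ih b'.toNat (by omega) b' a c' e' d' g' hb'_pos (by linarith)
        (by linear_combination hdet') y' x' z' rfl
      exact ⟨u, v, w, by rw [h]; ring⟩
    · obtain ⟨rfl, rfl, rfl⟩ := reduced_leading_coeffs_eq ha hge ht₁ ht₂ hA hA'
      exact ⟨x' + e' * z', y' + d' * z', z', by linear_combination -z' ^ 2 * hdet'⟩

theorem sum_three_sq_of_dvd {n d x : ℤ} (hd : 0 < d) (hm : 0 < d * n - 1)
    (h : d * n - 1 ∣ x ^ 2 + d) : ∃ u v w : ℤ, u ^ 2 + v ^ 2 + w ^ 2 = n := by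
  obtain ⟨a, ha⟩ := h
  have ha_pos : 0 < a := by
    by_contra! hle
    nlinarith [sq_nonneg x, mul_nonneg hm.le (neg_nonneg.2 hle)]
  obtain ⟨u, v, w, h⟩ := ternary_det_one_sum_three_sq a (d * n - 1) n 0 1 x ha_pos
    (by linarith [mul_comm a (d * n - 1)]) (by linear_combination -n * ha) 0 0 1
  exact ⟨u, v, w, by rw [h]; ring⟩

theorem exists_dvd_sq_add_of_jacobiSym {p d : ℕ} (hp : p.Prime)
    (h : jacobiSym (-d) p = 1) : ∃ x : ℤ, (p : ℤ) ∣ x ^ 2 + d := by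
  have := Fact.mk hp
  obtain ⟨y, hy⟩ := ZMod.isSquare_of_jacobiSym_eq_one h
  obtain ⟨x, rfl⟩ := ZMod.intCast_surjective y
  refine ⟨x, (ZMod.intCast_zmod_eq_zero_iff_dvd _ p).1 ?_⟩
  push_cast at hy ⊢
  linear_combination -hy

theorem sum_three_sq_of_mod_four_eq_two {n : ℕ} (hn : n % 4 = 2) :
    ∃ u v w : ℤ, u ^ 2 + v ^ 2 + w ^ 2 = n := by
  have hcop : (n - 1).Coprime (4 * n) := by
    refine Nat.Coprime.mul_right ?_ ?_
    · exact Nat.Coprime.pow_right 2 ((Nat.coprime_two_right).2 (Nat.odd_iff.2 (by omega)))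
    · have h := Nat.coprime_self_add_right (m := n - 1) (n := 1)
      rw [Nat.sub_add_cancel (by omega)] at h
      exact h.2 (Nat.coprime_one_right _)
  obtain ⟨p, hlt, hp, hmod⟩ := Nat.forall_exists_prime_gt_and_modEq n (by omega) hcop
  obtain ⟨j, hj⟩ := (Nat.modEq_iff_dvd' (by omega)).1 hmod.symm
  obtain ⟨d, hd⟩ : ∃ d, d = 4 * j + 1 := ⟨_, rfl⟩
  have hpd : (p : ℤ) = d * n - 1 := by
    have : p + 1 = d * n := by
      rw [hd, show (4 * j + 1) * n = 4 * n * j + n by ring]; omega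
    zify at this
    linarith
  have hp4 : p % 4 = 1 := by
    have : p + 1 = 4 * (n * j) + n := by rw [← mul_assoc]; omega
    omega
  have hJ : jacobiSym (-d) p = 1 := by
    have hpodd : Odd p := Nat.odd_iff.2 (by omega)
    have hdodd : Odd d := Nat.odd_iff.2 (by omega)
    rw [jacobiSym.neg _ hpodd, ZMod.χ₄_nat_one_mod_four hp4, one_mul,
      jacobiSym.quadratic_reciprocity_one_mod_four (by omega) hpodd,
      jacobiSym.mod_left' (b := d) (a₂ := -1)
        (Int.modEq_iff_dvd.2 ⟨-n, by rw [hpd]; ring⟩),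
      jacobiSym.at_neg_one hdodd, ZMod.χ₄_nat_one_mod_four (by omega)]
  obtain ⟨x, hx⟩ := exists_dvd_sq_add_of_jacobiSym hp hJ
  rw [hpd] at hx
  exact sum_three_sq_of_dvd (by omega) (hpd ▸ by exact_mod_cast hp.pos) hx

theorem sum_three_sq_of_odd {n : ℕ} (hn : n % 2 = 1) (hn8 : n % 8 ≠ 7) :
    ∃ u v w : ℤ, u ^ 2 + v ^ 2 + w ^ 2 = n := by
  obtain ⟨c, k, hc, hk, hk2⟩ : ∃ c k : ℕ, (c = 1 ∧ n % 8 = 3 ∨ c = 3 ∧ n % 4 = 1) ∧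
      2 * k + 1 = c * n ∧ k % 2 = 1 := by
    by_cases h : n % 8 = 3
    · exact ⟨1, n / 2, by omega, by omega, by omega⟩
    · exact ⟨3, 3 * n / 2, by omega, by omega, by omega⟩
  have hcop : k.Coprime (4 * n) := by
    refine Nat.Coprime.mul_right ?_ ?_
    · exact Nat.Coprime.pow_right 2 ((Nat.coprime_two_right).2 (Nat.odd_iff.2 hk2))
    · refine Nat.Coprime.coprime_mul_left_right (k := c) ?_
      rw [← hk]
      simp
  obtain ⟨p, hlt, hp, hmod⟩ := Nat.forall_exists_prime_gt_and_modEq k (by omega) hcop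
  obtain ⟨j, hj⟩ := (Nat.modEq_iff_dvd' (by omega)).1 hmod.symm
  obtain ⟨d, hd⟩ : ∃ d, d = 8 * j + c := ⟨_, rfl⟩
  have hpk : p = 4 * (n * j) + k := by rw [← mul_assoc]; omega
  have hpd : 2 * (p : ℤ) = d * n - 1 := by
    rw [hpk, hd]
    zify at hk
    push_cast
    linear_combination hk
  have hpodd : Odd p := Nat.odd_iff.2 (by omega)
  have hdodd : Odd d := Nat.odd_iff.2 (by omega)
  have hrec : jacobiSym (-d) p = jacobiSym p d := by
    rw [jacobiSym.neg _ hpodd]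
    have hmod : p % 4 = 1 ∨ p % 4 = 3 ∧ d % 4 = 3 := by
      rcases hc with ⟨rfl, h⟩ | ⟨rfl, h⟩ <;> omega
    rcases hmod with h | ⟨h, h'⟩
    · rw [ZMod.χ₄_nat_one_mod_four h, one_mul,
        jacobiSym.quadratic_reciprocity_one_mod_four' hdodd h]
    · rw [ZMod.χ₄_nat_three_mod_four h, jacobiSym.quadratic_reciprocity_three_mod_four h' h]
      ring
  have hneg_two : jacobiSym (-2) d = 1 := by
    rw [jacobiSym.at_neg_two hdodd, ZMod.χ₈'_nat_eq_if_mod_eight]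
    have : d % 8 = 1 ∨ d % 8 = 3 := by omega
    rcases this with h | h <;> simp [h] <;> omega
  have hJ : jacobiSym (-d) p = 1 := by
    have hmul := jacobiSym.mul_left (-2) p d
    rw [jacobiSym.mod_left' (a₂ := 1) (Int.modEq_iff_dvd.2 ⟨n, by linear_combination hpd⟩),
      jacobiSym.one_left, hneg_two, one_mul] at hmul
    rw [hrec, ← hmul]
  obtain ⟨x, hx, hxodd⟩ : ∃ x : ℤ, (p : ℤ) ∣ x ^ 2 + d ∧ x % 2 = 1 := by
    obtain ⟨x, hx⟩ := exists_dvd_sq_add_of_jacobiSym hp hJ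
    rcases Int.emod_two_eq_zero_or_one x with h | h
    · refine ⟨x + p, ?_, by have := Nat.odd_iff.1 hpodd; omega⟩
      rw [show (x + p) ^ 2 + (d : ℤ) = x ^ 2 + d + p * (2 * x + p) by ring]
      exact dvd_add hx (dvd_mul_right _ _)
    · exact ⟨x, hx, h⟩
  have hdvd : (d : ℤ) * n - 1 ∣ x ^ 2 + d := by
    rw [← hpd]
    refine IsCoprime.mul_dvd (Int.isCoprime_iff_gcd_eq_one.2 ?_) ?_ hx
    · exact_mod_cast (Nat.coprime_two_left).2 hpodd
    · exact (((Int.odd_iff.2 hxodd).pow).add_odd (by exact_mod_cast hdodd)).two_dvd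
  exact sum_three_sq_of_dvd (by omega) (hpd ▸ by have := hp.pos; omega) hdvd

theorem gcd_eq_one_of_not_four_dvd {x y z : ℤ} (h : ¬ 4 ∣ x ^ 2 + y ^ 2 + z ^ 2) (k : ℕ) :
    Int.gcd x (Int.gcd y (Int.gcd z (2 ^ k))) = 1 := by
  by_contra hne
  obtain ⟨p, hp, hdvd⟩ := Nat.exists_prime_and_dvd hne
  have hdvd' := Int.natCast_dvd_natCast.2 hdvd
  have hx := hdvd'.trans (Int.gcd_dvd_left _ _)
  have hyzw := hdvd'.trans (Int.gcd_dvd_right _ _)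
  have hy := hyzw.trans (Int.gcd_dvd_left _ _)
  have hzw := hyzw.trans (Int.gcd_dvd_right _ _)
  have hz := hzw.trans (Int.gcd_dvd_left _ _)
  have hw : p ∣ 2 ^ k := by exact_mod_cast hzw.trans (Int.gcd_dvd_right _ _)
  obtain rfl := (Nat.prime_dvd_prime_iff_eq hp Nat.prime_two).1 (hp.dvd_of_dvd_pow hw)
  exact h (dvd_add (dvd_add (pow_dvd_pow_of_dvd hx 2) (pow_dvd_pow_of_dvd hy 2))
    (pow_dvd_pow_of_dvd hz 2))

theorem exists_primitive_of_sum_three_sq {n m k : ℕ}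
    (hm : m % 4 = 2 ∨ m % 2 = 1 ∧ m % 8 ≠ 7) (hnm : n = m + 7 * (2 ^ k) ^ 2) :
    ∃ x y z w : ℤ, Int.gcd x (Int.gcd y (Int.gcd z w)) = 1 ∧
      x ^ 2 + y ^ 2 + z ^ 2 + 7 * w ^ 2 = (n : ℤ) := by
  obtain ⟨x, y, z, h⟩ : ∃ x y z : ℤ, x ^ 2 + y ^ 2 + z ^ 2 = m :=
    hm.elim sum_three_sq_of_mod_four_eq_two fun h => sum_three_sq_of_odd h.1 h.2
  refine ⟨x, y, z, 2 ^ k, gcd_eq_one_of_not_four_dvd (by rw [h]; omega) k, ?_⟩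
  rw [h, hnm]
  push_cast
  ring

theorem stmt_12 (n : ℕ) (hn : 0 < n) :
    (∃ x y z w : ℤ, Int.gcd x (Int.gcd y (Int.gcd z w)) = 1 ∧
      x ^ 2 + y ^ 2 + z ^ 2 + 7 * w ^ 2 = (n : ℤ)) ↔ n ≠ 4 := by
  constructor
  · rintro ⟨x, y, z, w, hgcd, h⟩ rfl
    push_cast at h
    obtain rfl : w = 0 := by
      by_contra hw
      have : 0 < w ^ 2 := by positivity
      nlinarith [sq_nonneg x, sq_nonneg y, sq_nonneg z]
    have hsq (a : ℤ) : a ^ 2 % 4 = if a % 2 = 0 then 0 else 1 := by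
      split_ifs with ha
      · exact Int.emod_eq_zero_of_dvd (pow_dvd_pow_of_dvd (Int.dvd_of_emod_eq_zero ha) 2)
      · exact Int.sq_mod_four_eq_one_of_odd (Int.odd_iff.2 (by omega))
    have heven : x % 2 = 0 ∧ y % 2 = 0 ∧ z % 2 = 0 := by
      have hx := hsq x
      have hy := hsq y
      have hz := hsq z
      split_ifs at hx hy hz <;> omega
    have hdvd : (2 : ℤ) ∣ Int.gcd x (Int.gcd y (Int.gcd z 0)) :=
      Int.dvd_coe_gcd (by omega) (Int.dvd_coe_gcd (by omega)
        (Int.dvd_coe_gcd (by omega) (by omega)))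
    omega
  · intro hne
    rcases (by omega : n % 8 = 0 ∨ n % 8 = 1 ∨ n % 8 = 2 ∨ n % 8 = 3 ∨ n % 8 = 4 ∨ n % 8 = 5 ∨
      n % 8 = 6 ∨ n % 8 = 7) with h | h | h | h | h | h | h | h
    · exact exists_primitive_of_sum_three_sq (m := n - 7) (k := 0) (by omega) (by omega)
    · rcases (by omega : n = 1 ∨ 7 < n) with rfl | hlt
      · exact ⟨1, 0, 0, 0, by decide, by norm_num⟩
      · exact exists_primitive_of_sum_three_sq (m := n - 7) (k := 0) (by omega) (by omega)
    · rcases (by omega : n = 2 ∨ 7 < n) with rfl | hlt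
      · exact ⟨1, 1, 0, 0, by decide, by norm_num⟩
      · exact exists_primitive_of_sum_three_sq (m := n - 7) (k := 0) (by omega) (by omega)
    · rcases lt_or_ge n 112 with hlt | hge
      · obtain ⟨j, hj, rfl⟩ : ∃ j < 14, n = 8 * j + 3 := ⟨n / 8, by omega, by omega⟩
        interval_cases j
        · exact ⟨1, 1, 1, 0, by decide, by norm_num⟩
        · exact ⟨3, 1, 1, 0, by decide, by norm_num⟩
        · exact ⟨3, 3, 1, 0, by decide, by norm_num⟩
        · exact ⟨5, 1, 1, 0, by decide, by norm_num⟩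
        · exact ⟨5, 3, 1, 0, by decide, by norm_num⟩
        · exact ⟨5, 3, 3, 0, by decide, by norm_num⟩
        · exact ⟨5, 5, 1, 0, by decide, by norm_num⟩
        · exact ⟨5, 5, 3, 0, by decide, by norm_num⟩
        · exact ⟨7, 3, 3, 0, by decide, by norm_num⟩
        · exact ⟨7, 5, 1, 0, by decide, by norm_num⟩
        · exact ⟨7, 5, 3, 0, by decide, by norm_num⟩
        · exact ⟨9, 3, 1, 0, by decide, by norm_num⟩
        · exact ⟨7, 5, 5, 0, by decide, by norm_num⟩
        · exact ⟨7, 7, 3, 0, by decide, by norm_num⟩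
      · exact exists_primitive_of_sum_three_sq (m := n - 112) (k := 2) (by omega) (by omega)
    · exact exists_primitive_of_sum_three_sq (m := n - 7) (k := 0) (by omega) (by omega)
    · rcases (by omega : n = 5 ∨ 7 < n) with rfl | hlt
      · exact ⟨2, 1, 0, 0, by decide, by norm_num⟩
      · exact exists_primitive_of_sum_three_sq (m := n - 7) (k := 0) (by omega) (by omega)
    · rcases (by omega : n = 6 ∨ n = 14 ∨ n = 22 ∨ 28 < n) with rfl | rfl | rfl | hlt
      · exact ⟨2, 1, 1, 0, by decide, by norm_num⟩
      · exact ⟨3, 2, 1, 0, by decide, by norm_num⟩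
      · exact ⟨3, 3, 2, 0, by decide, by norm_num⟩
      · exact exists_primitive_of_sum_three_sq (m := n - 28) (k := 1) (by omega) (by omega)
    · rcases (by omega : n = 7 ∨ n = 15 ∨ n = 23 ∨ 28 < n) with rfl | rfl | rfl | hlt
      · exact ⟨0, 0, 0, 1, by decide, by norm_num⟩
      · exact ⟨2, 2, 0, 1, by decide, by norm_num⟩
      · exact ⟨4, 0, 0, 1, by decide, by norm_num⟩
      · exact exists_primitive_of_sum_three_sq (m := n - 28) (k := 1) (by omega) (by omega)
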